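/- (Outlier Extraction error bound, precise form.) Let A, A_clean, A_out be real m×k matrices with A = A_clean + A_out and A_clean nonzero, let B be a nonzero real k×n matrix, let H be a real k×k matrix with Hᵀ * H = I, and let ε ≥ 0. Let Q_A be a real m×k matrix with ‖Q_A − A_clean*H‖_F ≤ ε·√(γ(A_clean*H))·‖A_clean‖_F and Q_B a real k×n matrix with ‖Q_B − Hᵀ*B‖_F ≤ ε·√(γ(Hᵀ*B))·‖B‖_F, where A_clean*H and Hᵀ*B are nonzero. Then ‖A·B − (Q_A·Q_B + A_out·B)‖_F ≤ ε·(√(γ(A_clean*H)) + √(γ(Hᵀ*B)) + ε·√(γ(A_clean*H)·γ(Hᵀ*B))) · ‖A_clean‖_F · ‖B‖_F. In particular, the error bound depends only on the residual A_clean and not on the extracted outlier part A_out, so Outlier Extraction eliminates the outlier-factor amplification √(γ(A)) of the full operand from the error bound. -/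

import Mathlib

open Matrix BigOperators

/-- The Frobenius norm of a real matrix: `‖M‖_F = sqrt (∑ i j, (M i j)^2)`. -/
noncomputable def frob {m n : ℕ} (M : Matrix (Fin m) (Fin n) ℝ) : ℝ :=
  Real.sqrt (∑ i, ∑ j, (M i j) ^ 2)

/-- The maximum absolute value of an entry of a real matrix. -/
noncomputable def maxAbs {m n : ℕ} (M : Matrix (Fin m) (Fin n) ℝ) : ℝ :=
  ⨆ i, ⨆ j, |M i j|

/-- The outlier factor `γ(M) = m·n·(max_{i,j} |M_{ij}|)² / ‖M‖_F²` of a real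
`m × n` matrix, measuring how concentrated its energy is in extreme values. -/
noncomputable def outlierFactor {m n : ℕ} (M : Matrix (Fin m) (Fin n) ℝ) : ℝ :=
  (m * n : ℝ) * (maxAbs M) ^ 2 / (frob M) ^ 2

section Frobenius

open scoped Matrix.Norms.Frobenius

lemma frob_eq_norm {m n : ℕ} (M : Matrix (Fin m) (Fin n) ℝ) : frob M = ‖M‖ := by
  simp [frob, Matrix.frobenius_norm_def, Real.sqrt_eq_rpow]

lemma frob_neg {m n : ℕ} (M : Matrix (Fin m) (Fin n) ℝ) : frob (-M) = frob M := by
  simp [frob]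

lemma frob_add_le {m n : ℕ} (M N : Matrix (Fin m) (Fin n) ℝ) :
    frob (M + N) ≤ frob M + frob N := by
  simpa only [frob_eq_norm] using norm_add_le M N

lemma frob_mul_le {m k n : ℕ} (M : Matrix (Fin m) (Fin k) ℝ) (N : Matrix (Fin k) (Fin n) ℝ) :
    frob (M * N) ≤ frob M * frob N := by
  simpa only [frob_eq_norm] using Matrix.frobenius_norm_mul M N

end Frobenius

lemma frob_nonneg {m n : ℕ} (M : Matrix (Fin m) (Fin n) ℝ) : 0 ≤ frob M :=
  Real.sqrt_nonneg _

lemma frob_eq_sqrt_trace {m n : ℕ} (M : Matrix (Fin m) (Fin n) ℝ) :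
    frob M = Real.sqrt (Mᵀ * M).trace := by
  simp only [frob, Matrix.trace, Matrix.diag, Matrix.mul_apply, Matrix.transpose_apply, sq]
  rw [Finset.sum_comm]

lemma frob_transpose {m n : ℕ} (M : Matrix (Fin m) (Fin n) ℝ) : frob Mᵀ = frob M := by
  simp only [frob, Matrix.transpose_apply]
  rw [Finset.sum_comm]

lemma frob_orthogonal_mul {k n : ℕ} {U : Matrix (Fin k) (Fin k) ℝ} (hU : Uᵀ * U = 1)
    (M : Matrix (Fin k) (Fin n) ℝ) : frob (U * M) = frob M := by
  rw [frob_eq_sqrt_trace, frob_eq_sqrt_trace, Matrix.transpose_mul, Matrix.mul_assoc,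
    ← Matrix.mul_assoc Uᵀ, hU, Matrix.one_mul]

lemma frob_mul_orthogonal {m k : ℕ} {U : Matrix (Fin k) (Fin k) ℝ} (hU : U * Uᵀ = 1)
    (M : Matrix (Fin m) (Fin k) ℝ) : frob (M * U) = frob M := by
  rw [← frob_transpose, Matrix.transpose_mul,
    frob_orthogonal_mul (by rwa [Matrix.transpose_transpose]), frob_transpose]

lemma frob_mul_sub_mul_le {m k n : ℕ} (X P : Matrix (Fin m) (Fin k) ℝ)
    (Y Q : Matrix (Fin k) (Fin n) ℝ) :
    frob (X * Y - P * Q) ≤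
      frob (P - X) * frob Y + frob X * frob (Q - Y) + frob (P - X) * frob (Q - Y) := by
  have h : X * Y - P * Q = -((P - X) * Y + X * (Q - Y) + (P - X) * (Q - Y)) := by
    simp only [Matrix.sub_mul, Matrix.mul_sub]
    abel
  rw [h, frob_neg]
  refine (frob_add_le _ _).trans (add_le_add ((frob_add_le _ _).trans ?_) (frob_mul_le _ _))
  exact add_le_add (frob_mul_le _ _) (frob_mul_le _ _)

lemma outlierFactor_nonneg {m n : ℕ} (M : Matrix (Fin m) (Fin n) ℝ) : 0 ≤ outlierFactor M := by
  unfold outlierFactor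
  positivity

/-- Outlier Extraction error bound. With `A = A_clean + A_out`,
the exact high-precision outlier path `A_out·B`, and quantized residual-path
operands `Q_A ≈ A_clean*H`, `Q_B ≈ Hᵀ*B`, the total error satisfies
`‖A·B − (Q_A·Q_B + A_out·B)‖_F ≤
  ε·(√γ(A_clean H) + √γ(HᵀB) + ε·√(γ(A_clean H)·γ(HᵀB)))·‖A_clean‖_F·‖B‖_F`,
depending only on the residual `A_clean` and not on the extracted part. -/
theorem oe_error_bound {m k n : ℕ}
    (A Aclean Aout : Matrix (Fin m) (Fin k) ℝ) (hA : A = Aclean + Aout)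
    (hAclean : Aclean ≠ 0)
    (B : Matrix (Fin k) (Fin n) ℝ) (hB : B ≠ 0)
    (H : Matrix (Fin k) (Fin k) ℝ) (hH : Hᵀ * H = 1)
    (ε : ℝ) (hε : 0 ≤ ε)
    (hAcH : Aclean * H ≠ 0) (hHB : Hᵀ * B ≠ 0)
    (QA : Matrix (Fin m) (Fin k) ℝ)
    (hQA : frob (QA - Aclean * H) ≤
      ε * Real.sqrt (outlierFactor (Aclean * H)) * frob Aclean)
    (QB : Matrix (Fin k) (Fin n) ℝ)
    (hQB : frob (QB - Hᵀ * B) ≤ ε * Real.sqrt (outlierFactor (Hᵀ * B)) * frob B) :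
    frob (A * B - (QA * QB + Aout * B)) ≤
      ε * (Real.sqrt (outlierFactor (Aclean * H)) + Real.sqrt (outlierFactor (Hᵀ * B)) +
          ε * Real.sqrt (outlierFactor (Aclean * H) * outlierFactor (Hᵀ * B))) *
        frob Aclean * frob B := by
  have hH' : H * Hᵀ = 1 := mul_eq_one_comm.mp hH
  have hprod : A * B - (QA * QB + Aout * B) = Aclean * H * (Hᵀ * B) - QA * QB := by
    rw [Matrix.mul_assoc Aclean, ← Matrix.mul_assoc H, hH', Matrix.one_mul, hA, Matrix.add_mul]
    abel
  have hX : frob (Aclean * H) = frob Aclean := frob_mul_orthogonal hH' Aclean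
  have hY : frob (Hᵀ * B) = frob B :=
    frob_orthogonal_mul (by rwa [Matrix.transpose_transpose]) B
  have hbound := frob_mul_sub_mul_le (Aclean * H) QA (Hᵀ * B) QB
  rw [hX, hY] at hbound
  rw [hprod, Real.sqrt_mul (outlierFactor_nonneg _)]
  have ha := frob_nonneg Aclean
  have h₁ := mul_le_mul_of_nonneg_right hQA (frob_nonneg B)
  have h₂ := mul_le_mul_of_nonneg_left hQB ha
  have h₃ := mul_le_mul hQA hQB (frob_nonneg _) (by positivity)
  linarith
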